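/- Let (β, γ, X_i, Y_j, N_h) be a bipartite coherent configuration with family of block matrices 𝒞, and set t̃_{βγ} := t_{βγ} − 1. Then there exist real matrices L_0,…,L_{t_β} (of size |β|×|β|), R_0,…,R_{t_γ} (of size |γ|×|γ|) and D_0,…,D_{t̃_{βγ}} (of size |β|×|γ|) whose associated block matrices [[L_r,0],[0,0]], [[0,0],[0,R_s]], [[0,D_h],[0,0]], [[0,0],[D_h^T,0]] form a basis of span_ℝ(𝒞), satisfying: (D1) L_r L_s = δ_{rs} L_r for 0 ≤ r,s ≤ t_β and R_r R_s = δ_{rs} R_r for 0 ≤ r,s ≤ t_γ; (D2) L_0 = J/|β|, D_0 = J/√(|β||γ|), R_0 = J/|γ|; (D3) Σ_{r=0}^{t_β} L_r = I and Σ_{r=0}^{t_γ} R_r = I; (D4) L_r = D_r D_r^T and R_r = D_r^T D_r for all 0 ≤ r ≤ t̃_{βγ}; (D5) the entrywise (Schur) product of any two of these block matrices lies in their span. -/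

import Mathlib

open Matrix

/-- A bipartite coherent configuration on point set `β` and block set `γ`, with
Schur idempotents `X 0, …, X tb` (on `β`), `Y 0, …, Y tg` (on `γ`) and
`N 1, …, N tbg` (from `β` to `γ`), satisfying (C1)–(C6). -/
structure BipartiteCC (β γ : Type) [Fintype β] [DecidableEq β] [Fintype γ] [DecidableEq γ] where
  tb : ℕ
  tg : ℕ
  tbg : ℕ
  tb_pos : 1 ≤ tb
  tg_pos : 1 ≤ tg
  tbg_pos : 1 ≤ tbg
  X : ℕ → Matrix β β ℝ
  Y : ℕ → Matrix γ γ ℝ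
  N : ℕ → Matrix β γ ℝ
  X_zero_one : ∀ i, i ≤ tb → ∀ u v, X i u v = 0 ∨ X i u v = 1
  Y_zero_one : ∀ j, j ≤ tg → ∀ u v, Y j u v = 0 ∨ Y j u v = 1
  N_zero_one : ∀ h, 1 ≤ h → h ≤ tbg → ∀ u v, N h u v = 0 ∨ N h u v = 1
  X_ne_zero : ∀ i, i ≤ tb → X i ≠ 0
  Y_ne_zero : ∀ j, j ≤ tg → Y j ≠ 0
  N_ne_zero : ∀ h, 1 ≤ h → h ≤ tbg → N h ≠ 0
  /-- (C1) -/
  X_zero : X 0 = 1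
  /-- (C1) -/
  Y_zero : Y 0 = 1
  /-- (C2), `ββ` block -/
  X_sum : ∑ i ∈ Finset.range (tb + 1), X i = Matrix.of fun _ _ => (1 : ℝ)
  /-- (C2), `γγ` block -/
  Y_sum : ∑ j ∈ Finset.range (tg + 1), Y j = Matrix.of fun _ _ => (1 : ℝ)
  /-- (C2), `βγ` block -/
  N_sum : ∑ h ∈ Finset.Icc 1 tbg, N h = Matrix.of fun _ _ => (1 : ℝ)
  /-- (C3) -/
  X_transpose : ∀ i, i ≤ tb → ∃ i', i' ≤ tb ∧ (X i)ᵀ = X i'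
  /-- (C3) -/
  Y_transpose : ∀ j, j ≤ tg → ∃ j', j' ≤ tg ∧ (Y j)ᵀ = Y j'
  /-- (C4) -/
  X_mul_X : ∀ i, i ≤ tb → ∀ j, j ≤ tb →
      X i * X j ∈ Submodule.span ℝ {M | ∃ i', i' ≤ tb ∧ M = X i'}
  /-- (C4) -/
  Y_mul_Y : ∀ i, i ≤ tg → ∀ j, j ≤ tg →
      Y i * Y j ∈ Submodule.span ℝ {M | ∃ j', j' ≤ tg ∧ M = Y j'}
  /-- (C4) -/
  X_mul_N : ∀ i, i ≤ tb → ∀ h, 1 ≤ h → h ≤ tbg →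
      X i * N h ∈ Submodule.span ℝ {M | ∃ h', 1 ≤ h' ∧ h' ≤ tbg ∧ M = N h'}
  /-- (C4) -/
  N_mul_Y : ∀ h, 1 ≤ h → h ≤ tbg → ∀ j, j ≤ tg →
      N h * Y j ∈ Submodule.span ℝ {M | ∃ h', 1 ≤ h' ∧ h' ≤ tbg ∧ M = N h'}
  /-- (C4) -/
  N_mul_Nt : ∀ h, 1 ≤ h → h ≤ tbg → ∀ h', 1 ≤ h' → h' ≤ tbg →
      N h * (N h')ᵀ ∈ Submodule.span ℝ {M | ∃ i, i ≤ tb ∧ M = X i}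
  /-- (C4) -/
  Nt_mul_N : ∀ h, 1 ≤ h → h ≤ tbg → ∀ h', 1 ≤ h' → h' ≤ tbg →
      (N h)ᵀ * N h' ∈ Submodule.span ℝ {M | ∃ j, j ≤ tg ∧ M = Y j}
  /-- (C5) -/
  N_comm : ∀ i, 1 ≤ i → i ≤ tbg → ∀ j, 1 ≤ j → j ≤ tbg → N i * (N j)ᵀ = N j * (N i)ᵀ
  /-- (C5) -/
  Nt_comm : ∀ i, 1 ≤ i → i ≤ tbg → ∀ j, 1 ≤ j → j ≤ tbg → (N i)ᵀ * N j = (N j)ᵀ * N i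
  /-- (C6) -/
  X_span : Submodule.span ℝ {M | ∃ i, i ≤ tb ∧ M = X i} =
      Submodule.span ℝ
        (insert 1 {M | ∃ i, 1 ≤ i ∧ i ≤ tbg ∧ ∃ j, 1 ≤ j ∧ j ≤ tbg ∧ M = N i * (N j)ᵀ})
  /-- (C6) -/
  Y_span : Submodule.span ℝ {M | ∃ j, j ≤ tg ∧ M = Y j} =
      Submodule.span ℝ
        (insert 1 {M | ∃ i, 1 ≤ i ∧ i ≤ tbg ∧ ∃ j, 1 ≤ j ∧ j ≤ tbg ∧ M = (N i)ᵀ * N j})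

/-- A second (spectral) basis `L 0, …, L tb`, `R 0, …, R tg`, `D 0, …, D (tbg - 1)` for a
bipartite coherent configuration, satisfying (D1)–(D4). -/
structure SecondBasis {β γ : Type} [Fintype β] [DecidableEq β] [Fintype γ] [DecidableEq γ]
    (cc : BipartiteCC β γ) where
  L : ℕ → Matrix β β ℝ
  R : ℕ → Matrix γ γ ℝ
  D : ℕ → Matrix β γ ℝ
  /-- the `L`'s are linearly independent -/
  L_indep : LinearIndependent ℝ (fun r : Fin (cc.tb + 1) => L r.val)
  /-- the `R`'s are linearly independent -/
  R_indep : LinearIndependent ℝ (fun r : Fin (cc.tg + 1) => R r.val)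
  /-- the `D`'s are linearly independent -/
  D_indep : LinearIndependent ℝ (fun r : Fin cc.tbg => D r.val)
  /-- the `L`'s span the same space as the `X`'s -/
  L_span : Submodule.span ℝ {M | ∃ r, r ≤ cc.tb ∧ M = L r} =
      Submodule.span ℝ {M | ∃ i, i ≤ cc.tb ∧ M = cc.X i}
  /-- the `R`'s span the same space as the `Y`'s -/
  R_span : Submodule.span ℝ {M | ∃ r, r ≤ cc.tg ∧ M = R r} =
      Submodule.span ℝ {M | ∃ j, j ≤ cc.tg ∧ M = cc.Y j}
  /-- the `D`'s span the same space as the `N`'s -/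
  D_span : Submodule.span ℝ {M | ∃ r, r ≤ cc.tbg - 1 ∧ M = D r} =
      Submodule.span ℝ {M | ∃ h, 1 ≤ h ∧ h ≤ cc.tbg ∧ M = cc.N h}
  /-- (D1) -/
  L_mul_L : ∀ r, r ≤ cc.tb → ∀ s, s ≤ cc.tb → L r * L s = if r = s then L r else 0
  /-- (D1) -/
  R_mul_R : ∀ r, r ≤ cc.tg → ∀ s, s ≤ cc.tg → R r * R s = if r = s then R r else 0
  /-- (D2) -/
  L_zero : L 0 = ((Fintype.card β : ℝ))⁻¹ • Matrix.of fun _ _ => (1 : ℝ)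
  /-- (D2) -/
  D_zero : D 0 = (Real.sqrt ((Fintype.card β : ℝ) * (Fintype.card γ : ℝ)))⁻¹ •
      Matrix.of fun _ _ => (1 : ℝ)
  /-- (D2) -/
  R_zero : R 0 = ((Fintype.card γ : ℝ))⁻¹ • Matrix.of fun _ _ => (1 : ℝ)
  /-- (D3) -/
  L_sum : ∑ r ∈ Finset.range (cc.tb + 1), L r = 1
  /-- (D3) -/
  R_sum : ∑ r ∈ Finset.range (cc.tg + 1), R r = 1
  /-- (D4) -/
  L_eq_DDt : ∀ r, r ≤ cc.tbg - 1 → L r = D r * (D r)ᵀ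
  /-- (D4) -/
  R_eq_DtD : ∀ r, r ≤ cc.tbg - 1 → R r = (D r)ᵀ * D r

/-- Nonzero orthogonal idempotents are linearly independent. -/
theorem linearIndependent_of_orthogonal_idempotents {A ι : Type*} [Ring A] [Algebra ℝ A]
    [DecidableEq ι] {e : ι → A} (hne : ∀ i, e i ≠ 0)
    (hmul : ∀ i j, e i * e j = if i = j then e i else 0) : LinearIndependent ℝ e := by
  rw [linearIndependent_iff']
  intro s g hg i hi
  have h := congrArg (fun a => a * e i) hg
  simp only [Finset.sum_mul, smul_mul_assoc, hmul, smul_ite, smul_zero, zero_mul,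
    Finset.sum_ite_eq', hi, if_true] at h
  exact (smul_eq_zero.mp h).resolve_right (hne i)

theorem range_fin_val_eq_image {A : Type*} (f : ℕ → A) (m : ℕ) :
    Set.range (fun r : Fin m => f r.val) = f '' {r | r < m} := by
  ext x
  constructor
  · rintro ⟨r, rfl⟩
    exact ⟨r, r.2, rfl⟩
  · rintro ⟨r, hr, rfl⟩
    exact ⟨⟨r, hr⟩, rfl⟩

theorem setOf_exists_le_eq {A : Type*} (f : ℕ → A) (t : ℕ) :
    {M | ∃ i, i ≤ t ∧ M = f i} = Set.range (fun i : Fin (t + 1) => f i.val) := by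
  ext x
  constructor
  · rintro ⟨i, hi, rfl⟩
    exact ⟨⟨i, by omega⟩, rfl⟩
  · rintro ⟨i, rfl⟩
    exact ⟨i, by omega, rfl⟩

theorem setOf_exists_one_le_eq {A : Type*} (f : ℕ → A) (t : ℕ) :
    {M | ∃ i, 1 ≤ i ∧ i ≤ t ∧ M = f i} = Set.range (fun i : Fin t => f (i.val + 1)) := by
  ext x
  constructor
  · rintro ⟨i, hi, hit, rfl⟩
    exact ⟨⟨i - 1, by omega⟩, by simp [Nat.sub_add_cancel hi]⟩
  · rintro ⟨i, rfl⟩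
    exact ⟨i + 1, by omega, by omega, rfl⟩

/-- Orthogonal idempotents can be completed by `1 - ∑ P r`, if necessary, to a system of
orthogonal idempotents with sum `1` which is a basis of the span of the `P r` and `1`. -/
theorem exists_complete_orthogonal_idempotents {A : Type*} [Ring A] [Algebra ℝ A] {n t : ℕ}
    {P : ℕ → A} (hne : ∀ r < n, P r ≠ 0)
    (hmul : ∀ r < n, ∀ s < n, P r * P s = if r = s then P r else 0) {W : Submodule ℝ A}
    (hW : W = Submodule.span ℝ (insert 1 (P '' {r | r < n})))
    (hrank : Module.finrank ℝ W = t + 1) :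
    ∃ L : ℕ → A, (∀ r < n, L r = P r) ∧
      (∀ r < t + 1, ∀ s < t + 1, L r * L s = if r = s then L r else 0) ∧
      ∑ r ∈ Finset.range (t + 1), L r = 1 ∧
      LinearIndependent ℝ (fun r : Fin (t + 1) => L r.val) ∧
      Submodule.span ℝ (Set.range (fun r : Fin (t + 1) => L r.val)) = W := by
  have key : ∀ (m : ℕ) (L : ℕ → A), (∀ r < n, L r = P r) → (∀ r < m, L r ≠ 0) →
      (∀ r < m, ∀ s < m, L r * L s = if r = s then L r else 0) →
      ∑ r ∈ Finset.range m, L r = 1 →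
      Submodule.span ℝ (Set.range (fun r : Fin m => L r.val)) = W →
      ∃ L : ℕ → A, (∀ r < n, L r = P r) ∧
        (∀ r < t + 1, ∀ s < t + 1, L r * L s = if r = s then L r else 0) ∧
        ∑ r ∈ Finset.range (t + 1), L r = 1 ∧
        LinearIndependent ℝ (fun r : Fin (t + 1) => L r.val) ∧
        Submodule.span ℝ (Set.range (fun r : Fin (t + 1) => L r.val)) = W := by
    intro m L hLP hL0 hLmul hLsum hLspan
    have hind : LinearIndependent ℝ (fun r : Fin m => L r.val) :=
      linearIndependent_of_orthogonal_idempotents (fun i => hL0 i i.2)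
        (fun i j => by simp [hLmul i i.2 j j.2, Fin.ext_iff])
    have hm : m = t + 1 := by
      rw [← hrank, ← hLspan, finrank_span_eq_card hind, Fintype.card_fin]
    subst hm
    exact ⟨L, hLP, hLmul, hLsum, hind, hLspan⟩
  by_cases h1 : ∑ r ∈ Finset.range n, P r = 1
  · refine key n P (fun _ _ => rfl) hne hmul h1 ?_
    rw [hW, range_fin_val_eq_image, Submodule.span_insert_eq_span]
    rw [← h1]
    exact Submodule.sum_mem _ fun r hr =>
      Submodule.subset_span ⟨r, Finset.mem_range.mp hr, rfl⟩
  · set Q : A := 1 - ∑ r ∈ Finset.range n, P r with hQ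
    have hPQ : ∀ r < n, P r * Q = 0 := by
      intro r hr
      rw [hQ, mul_sub, mul_one, Finset.mul_sum, Finset.sum_congr rfl
        (fun s hs => hmul r hr s (Finset.mem_range.mp hs))]
      simp [hr]
    have hQP : ∀ r < n, Q * P r = 0 := by
      intro r hr
      rw [hQ, sub_mul, one_mul, Finset.sum_mul, Finset.sum_congr rfl
        (fun s hs => hmul s (Finset.mem_range.mp hs) r hr)]
      simp [hr]
    have hQQ : Q * Q = Q := by
      nth_rewrite 1 [hQ]
      rw [sub_mul, one_mul, Finset.sum_mul,
        Finset.sum_eq_zero (fun r hr => hPQ r (Finset.mem_range.mp hr)), sub_zero]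
    have hsum : ∑ r ∈ Finset.range (n + 1), (if r < n then P r else Q) = 1 := by
      rw [Finset.sum_range_succ, Finset.sum_congr rfl
        (fun r hr => if_pos (Finset.mem_range.mp hr)), if_neg (lt_irrefl n), hQ]
      abel
    refine key (n + 1) (fun r => if r < n then P r else Q) (fun r hr => if_pos hr) ?_ ?_ hsum ?_
    · intro r hr
      by_cases hrn : r < n
      · simpa [hrn] using hne r hrn
      · simpa [hrn, hQ, sub_eq_zero] using fun h => h1 h.symm
    · intro r hr s hs
      by_cases hrn : r < n <;> by_cases hsn : s < n
      · simp only [hrn, hsn, if_true, hmul r hrn s hsn]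
      · have : r ≠ s := by omega
        simp [hrn, hsn, this, hPQ r hrn]
      · have : r ≠ s := by omega
        simp [hrn, hsn, this, hQP s hsn]
      · have : r = s := by omega
        simp [hsn, this, hQQ]
    · rw [hW]
      apply le_antisymm
      · rw [Submodule.span_le]
        rintro _ ⟨r, rfl⟩
        have hP : ∀ s < n, P s ∈ Submodule.span ℝ (insert 1 (P '' {r | r < n})) :=
          fun s hs => Submodule.subset_span (Or.inr ⟨s, hs, rfl⟩)
        by_cases hrn : r.val < n
        · simpa [hrn] using hP r hrn
        · simp only [hrn, if_false, SetLike.mem_coe]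
          exact Submodule.sub_mem _ (Submodule.subset_span (Or.inl rfl))
            (Submodule.sum_mem _ fun s hs => hP s (Finset.mem_range.mp hs))
      · rw [Submodule.span_le, range_fin_val_eq_image (fun r => if r < n then P r else Q)]
        rintro _ (rfl | ⟨r, hr, rfl⟩)
        · rw [SetLike.mem_coe, ← hsum]
          exact Submodule.sum_mem _ fun r hr =>
            Submodule.subset_span ⟨r, Finset.mem_range.mp hr, rfl⟩
        · exact Submodule.subset_span ⟨r, Nat.lt_succ_of_lt hr, if_pos hr⟩

section Partition

variable {m n ι : Type*} [Fintype ι] [DecidableEq ι] {M : ι → Matrix m n ℝ}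

theorem hadamard_eq_ite_of_partition (h01 : ∀ i u v, M i u v = 0 ∨ M i u v = 1)
    (hsum : ∑ i, M i = Matrix.of fun _ _ => (1 : ℝ)) (i j : ι) :
    Matrix.hadamard (M i) (M j) = if i = j then M i else 0 := by
  ext u v
  have hs : ∑ k, M k u v = 1 := by
    simpa [Matrix.sum_apply] using congrFun (congrFun hsum u) v
  split_ifs with hij
  · subst hij
    rcases h01 i u v with h | h <;> simp [h]
  · rcases h01 i u v with h | h
    · simp [h]
    rcases h01 j u v with h' | h'
    · simp [h']
    have h0 : ∀ k, 0 ≤ M k u v := fun k => by rcases h01 k u v with h | h <;> simp [h]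
    have := Finset.sum_le_sum_of_subset_of_nonneg (Finset.subset_univ {i, j})
      (fun k _ _ => h0 k) (f := fun k => M k u v)
    rw [Finset.sum_pair hij, hs, h, h'] at this
    norm_num at this

theorem linearIndependent_of_partition (h01 : ∀ i u v, M i u v = 0 ∨ M i u v = 1)
    (hsum : ∑ i, M i = Matrix.of fun _ _ => (1 : ℝ)) (hne : ∀ i, M i ≠ 0) :
    LinearIndependent ℝ M :=
  linearIndependent_of_orthogonal_idempotents (A := m → n → ℝ) (e := M) hne
    (hadamard_eq_ite_of_partition h01 hsum)

theorem hadamard_mem_span_of_partition (h01 : ∀ i u v, M i u v = 0 ∨ M i u v = 1)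
    (hsum : ∑ i, M i = Matrix.of fun _ _ => (1 : ℝ)) {A B : Matrix m n ℝ}
    (hA : A ∈ Submodule.span ℝ (Set.range M)) (hB : B ∈ Submodule.span ℝ (Set.range M)) :
    Matrix.hadamard A B ∈ Submodule.span ℝ (Set.range M) := by
  induction hA using Submodule.span_induction with
  | zero => simp
  | add x y _ _ hx hy => rw [Matrix.add_hadamard]; exact Submodule.add_mem _ hx hy
  | smul a x _ hx => rw [Matrix.smul_hadamard]; exact Submodule.smul_mem _ _ hx
  | mem x hx =>
    obtain ⟨i, rfl⟩ := hx
    induction hB using Submodule.span_induction with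
    | zero => simp
    | add x y _ _ hx hy => rw [Matrix.hadamard_add]; exact Submodule.add_mem _ hx hy
    | smul a x _ hx => rw [Matrix.hadamard_smul]; exact Submodule.smul_mem _ _ hx
    | mem x hx =>
      obtain ⟨j, rfl⟩ := hx
      rw [hadamard_eq_ite_of_partition h01 hsum]
      split_ifs
      · exact Submodule.subset_span ⟨i, rfl⟩
      · exact Submodule.zero_mem _

end Partition

section TripleSystem

variable {β γ : Type*} [Fintype β] [Fintype γ]

/-- A space of rectangular matrices closed under `M * Nᵀ * P` on which this triple product is
totally symmetric. -/
structure IsCommTripleSystem (V : Submodule ℝ (Matrix β γ ℝ)) : Prop where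
  mul_transpose_comm : ∀ M ∈ V, ∀ N ∈ V, M * Nᵀ = N * Mᵀ
  transpose_mul_comm : ∀ M ∈ V, ∀ N ∈ V, Mᵀ * N = Nᵀ * M
  triple_mem : ∀ M ∈ V, ∀ N ∈ V, ∀ P ∈ V, M * Nᵀ * P ∈ V

/-- The tripotents of `V` spanning a line stable under all the operators `M * Nᵀ`. -/
def eigenTripotents (V : Submodule ℝ (Matrix β γ ℝ)) : Set (Matrix β γ ℝ) :=
  {D | D ∈ V ∧ D ≠ 0 ∧ D * Dᵀ * D = D ∧ ∀ M ∈ V, ∀ N ∈ V, ∃ c : ℝ, M * Nᵀ * D = c • D}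

theorem eq_zero_of_mul_transpose_self {m n : Type*} [Fintype n] {A : Matrix m n ℝ}
    (h : A * Aᵀ = 0) : A = 0 := by
  rwa [← Matrix.conjTranspose_eq_transpose_of_trivial,
    Matrix.self_mul_conjTranspose_eq_zero] at h

theorem eq_zero_of_transpose_mul_self {m n : Type*} [Fintype m] {A : Matrix m n ℝ}
    (h : Aᵀ * A = 0) : A = 0 := by
  rwa [← Matrix.conjTranspose_eq_transpose_of_trivial,
    Matrix.conjTranspose_mul_self_eq_zero] at h

namespace IsCommTripleSystem

variable {V : Submodule ℝ (Matrix β γ ℝ)}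

theorem triple_rotate (hV : IsCommTripleSystem V) {M N P : Matrix β γ ℝ} (hM : M ∈ V)
    (hN : N ∈ V) (hP : P ∈ V) : M * Nᵀ * P = P * Mᵀ * N := by
  rw [Matrix.mul_assoc, hV.transpose_mul_comm N hN P hP, ← Matrix.mul_assoc,
    hV.mul_transpose_comm M hM P hP]

theorem orthogonal (hV : IsCommTripleSystem V) {D E : Matrix β γ ℝ}
    (hD : D ∈ eigenTripotents V) (hE : E ∈ eigenTripotents V)
    (hDE : LinearIndependent ℝ ![D, E]) : D * Eᵀ = 0 ∧ Dᵀ * E = 0 := by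
  obtain ⟨hDV, -, -, hD⟩ := hD
  obtain ⟨hEV, -, -, hE⟩ := hE
  obtain ⟨c, hc⟩ := hD E hEV E hEV
  obtain ⟨c', hc'⟩ := hE D hDV E hEV
  have h := hV.triple_rotate hEV hEV hDV
  have hc0 : c = 0 := by
    refine (LinearIndependent.pair_iff.mp hDE c (-c') ?_).1
    rw [← hc, neg_smul, ← hc', h, add_neg_cancel]
  rw [hc0, zero_smul] at hc
  rw [hc] at h
  constructor
  · apply eq_zero_of_mul_transpose_self
    rw [Matrix.transpose_mul, Matrix.transpose_transpose, ← Matrix.mul_assoc, ← h,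
      Matrix.zero_mul]
  · apply eq_zero_of_mul_transpose_self
    rw [Matrix.transpose_mul, Matrix.transpose_transpose, Matrix.mul_assoc, ← Matrix.mul_assoc E,
      hc, Matrix.mul_zero]

/-- Left multiplication by `M * Nᵀ` on a commutative triple system. -/
def leftMul (hV : IsCommTripleSystem V) (p : V × V) : V →ₗ[ℝ] V where
  toFun P := ⟨p.1.1 * p.2.1ᵀ * P.1, hV.triple_mem _ p.1.2 _ p.2.2 _ P.2⟩
  map_add' _ _ := Subtype.ext (Matrix.mul_add _ _ _)
  map_smul' _ _ := Subtype.ext (Matrix.mul_smul _ _ _)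

theorem commute_leftMul (hV : IsCommTripleSystem V) (p q : V × V) :
    Commute (hV.leftMul p) (hV.leftMul q) := by
  obtain ⟨⟨M, hM⟩, ⟨N, hN⟩⟩ := p
  obtain ⟨⟨P, hP⟩, ⟨Q, hQ⟩⟩ := q
  refine LinearMap.ext fun R => Subtype.ext ?_
  obtain ⟨R, hR⟩ := R
  change M * Nᵀ * (P * Qᵀ * R) = P * Qᵀ * (M * Nᵀ * R)
  rw [hV.triple_rotate hM hN (hV.triple_mem _ hP _ hQ _ hR), hV.triple_rotate hM hN hR]
  simp only [Matrix.mul_assoc]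

theorem mem_span_of_eigen {D : Matrix β γ ℝ} (hD : D ∈ V)
    (h : ∀ M ∈ V, ∀ N ∈ V, ∃ c : ℝ, M * Nᵀ * D = c • D) :
    D ∈ Submodule.span ℝ (eigenTripotents V) := by
  by_cases hD0 : D = 0
  · rw [hD0]
    exact Submodule.zero_mem _
  obtain ⟨c, hc⟩ := h D hD D hD
  have htr : (D * Dᵀ).trace ≠ 0 ∧ 0 ≤ (D * Dᵀ).trace := by
    rw [← Matrix.conjTranspose_eq_transpose_of_trivial]
    exact ⟨fun h0 => hD0 (Matrix.trace_mul_conjTranspose_self_eq_zero_iff.mp h0),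
      (Matrix.posSemidef_self_mul_conjTranspose D).trace_nonneg⟩
  have hsq : 0 ≤ ((D * Dᵀ) * (D * Dᵀ)ᵀ).trace := by
    rw [← Matrix.conjTranspose_eq_transpose_of_trivial (D * Dᵀ)]
    exact (Matrix.posSemidef_self_mul_conjTranspose _).trace_nonneg
  have hsq' : ((D * Dᵀ) * (D * Dᵀ)ᵀ).trace = c * (D * Dᵀ).trace := by
    rw [Matrix.transpose_mul, Matrix.transpose_transpose, ← Matrix.mul_assoc, hc,
      Matrix.smul_mul, Matrix.trace_smul, smul_eq_mul]
  have hc0 : c ≠ 0 := by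
    rintro rfl
    rw [zero_smul] at hc
    apply hD0
    apply eq_zero_of_mul_transpose_self
    apply eq_zero_of_mul_transpose_self
    rw [Matrix.transpose_mul, Matrix.transpose_transpose, ← Matrix.mul_assoc, hc, Matrix.zero_mul]
  have hcpos : 0 < c := by
    rw [hsq'] at hsq
    have : 0 < (D * Dᵀ).trace := lt_of_le_of_ne htr.2 htr.1.symm
    exact lt_of_le_of_ne (nonneg_of_mul_nonneg_left hsq this) hc0.symm
  have hs : Real.sqrt c ≠ 0 := (Real.sqrt_pos.mpr hcpos).ne'
  have hmem : (Real.sqrt c)⁻¹ • D ∈ eigenTripotents V := by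
    refine ⟨V.smul_mem _ hD, smul_ne_zero (inv_ne_zero hs) hD0, ?_, fun M hM N hN => ?_⟩
    · simp only [Matrix.transpose_smul, Matrix.smul_mul, Matrix.mul_smul, hc, smul_smul]
      congr 1
      field_simp
      rw [Real.sq_sqrt hcpos.le]
    · obtain ⟨d, hd⟩ := h M hM N hN
      exact ⟨d, by rw [Matrix.mul_smul, hd, smul_comm]⟩
  have := Submodule.smul_mem _ (Real.sqrt c) (Submodule.subset_span (R := ℝ) hmem)
  rwa [smul_smul, mul_inv_cancel₀ hs, one_smul] at this

theorem le_span_eigenTripotents (hV : IsCommTripleSystem V) :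
    V ≤ Submodule.span ℝ (eigenTripotents V) := by
  let core : InnerProductSpace.Core ℝ V :=
    { inner := fun P Q => (P.1 * Q.1ᵀ).trace
      conj_inner_symm := fun P Q => by
        simp only [conj_trivial]
        rw [hV.mul_transpose_comm _ P.2 _ Q.2]
      re_inner_nonneg := fun P => by
        rw [← Matrix.conjTranspose_eq_transpose_of_trivial]
        exact (Matrix.posSemidef_self_mul_conjTranspose P.1).trace_nonneg
      add_left := fun P Q R => by simp [Matrix.add_mul]
      smul_left := fun P Q c => by simp
      definite := fun P h => by
        rw [← Matrix.conjTranspose_eq_transpose_of_trivial] at h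
        exact Subtype.ext (Matrix.trace_mul_conjTranspose_self_eq_zero_iff.mp h) }
  let _ : NormedAddCommGroup V := core.toNormedAddCommGroup
  let _ : InnerProductSpace ℝ V := InnerProductSpace.ofCore core.toCore
  have hsymm : ∀ p, (hV.leftMul p).IsSymmetric := by
    intro p P Q
    change (p.1.1 * p.2.1ᵀ * P.1 * Q.1ᵀ).trace = (P.1 * (p.1.1 * p.2.1ᵀ * Q.1)ᵀ).trace
    conv_lhs =>
      rw [Matrix.mul_assoc, Matrix.trace_mul_comm, hV.mul_transpose_comm _ p.1.2 _ p.2.2]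
    simp only [Matrix.transpose_mul, Matrix.transpose_transpose, Matrix.mul_assoc]
  have htop := LinearMap.IsSymmetric.iSup_iInf_eq_top_of_commute hsymm
    (fun p q _ => hV.commute_leftMul p q)
  intro D hD
  have hle : (⨆ χ : V × V → ℝ, ⨅ p, Module.End.eigenspace (hV.leftMul p) (χ p)) ≤
      (Submodule.span ℝ (eigenTripotents V)).comap V.subtype := by
    refine iSup_le fun χ P hP => ?_
    rw [Submodule.mem_iInf] at hP
    refine mem_span_of_eigen P.2 fun M hM N hN => ⟨χ (⟨M, hM⟩, ⟨N, hN⟩), ?_⟩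
    exact congrArg Subtype.val (Module.End.mem_eigenspace_iff.mp (hP (⟨M, hM⟩, ⟨N, hN⟩)))
  rw [htop] at hle
  exact hle (Submodule.mem_top (x := ⟨D, hD⟩))

/-- A commutative triple system has a basis of pairwise orthogonal tripotents, which may be
chosen to begin with any given eigentripotent. -/
theorem exists_orthogonal_basis (hV : IsCommTripleSystem V) {n : ℕ} (hn : 0 < n)
    (hrank : Module.finrank ℝ V = n) {D₀ : Matrix β γ ℝ} (hD₀ : D₀ ∈ eigenTripotents V) :
    ∃ D : ℕ → Matrix β γ ℝ, D 0 = D₀ ∧ (∀ r < n, D r ∈ eigenTripotents V) ∧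
      LinearIndependent ℝ (fun r : Fin n => D r.val) ∧
      Submodule.span ℝ (Set.range (fun r : Fin n => D r.val)) = V ∧
      ∀ r < n, ∀ s < n, r ≠ s → D r * (D s)ᵀ = 0 ∧ (D r)ᵀ * D s = 0 := by
  obtain ⟨b, hbS, hDb, hSb, hb⟩ := exists_linearIndepOn_id_extension (K := ℝ)
    (LinearIndepOn.singleton (v := id) hD₀.2.1) (Set.singleton_subset_iff.mpr hD₀)
  have hspan : Submodule.span ℝ b = V := by
    refine le_antisymm (Submodule.span_le.mpr fun x hx => (hbS hx).1) ?_
    exact hV.le_span_eigenTripotents.trans (Submodule.span_le.mpr hSb)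
  have hb' : LinearIndependent ℝ (Subtype.val : b → Matrix β γ ℝ) := hb
  have : Fintype b := hb'.setFinite.fintype
  have hcard : Fintype.card b = n := by
    rw [← hrank, ← hspan]
    conv_rhs => rw [← Subtype.range_coe (s := b)]
    exact (finrank_span_eq_card hb').symm
  let e₀ : Fin n ≃ b := (Fintype.equivFinOfCardEq hcard).symm
  let e : Fin n ≃ b := (Equiv.swap ⟨0, hn⟩ (e₀.symm ⟨D₀, hDb rfl⟩)).trans e₀
  have he : e ⟨0, hn⟩ = ⟨D₀, hDb rfl⟩ := by simp [e]
  have hfun : (fun r : Fin n => if h : r.val < n then (e ⟨r.val, h⟩).val else 0) =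
      Subtype.val ∘ e := by
    ext r : 1
    simp
  refine ⟨fun r => if h : r < n then (e ⟨r, h⟩).val else 0, by simp [hn, he], ?_, ?_, ?_, ?_⟩
  · intro r hr
    simpa [hr] using hbS (e ⟨r, hr⟩).2
  · rw [hfun]
    exact hb'.comp e e.injective
  · rw [hfun, e.surjective.range_comp, Subtype.range_coe, hspan]
  · intro r hr s hs hrs
    simp only [hr, hs, dif_pos]
    refine hV.orthogonal (hbS (e ⟨r, hr⟩).2) (hbS (e ⟨s, hs⟩).2) ?_
    have h := hb'.comp (e ∘ ![⟨r, hr⟩, ⟨s, hs⟩]) (e.injective.comp ?_)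
    · convert h using 1
      ext i : 1
      fin_cases i <;> rfl
    · intro i j hij
      fin_cases i <;> fin_cases j <;> simp_all [eq_comm]

end IsCommTripleSystem

end TripleSystem

theorem transpose_mem_span {l m : Type*} {s : Set (Matrix l m ℝ)} {A : Matrix l m ℝ}
    (hA : A ∈ Submodule.span ℝ s) : Aᵀ ∈ Submodule.span ℝ (Matrix.transpose '' s) := by
  have := Submodule.mem_map_of_mem (f := (Matrix.transposeLinearEquiv l m ℝ ℝ).toLinearMap) hA
  rwa [Submodule.map_span] at this

section SpanMul

variable {l m n : Type*} [Fintype m]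

theorem mul_mem_of_mem_span {s : Set (Matrix l m ℝ)} {t : Set (Matrix m n ℝ)}
    {W : Submodule ℝ (Matrix l n ℝ)} (h : ∀ x ∈ s, ∀ y ∈ t, x * y ∈ W) {A : Matrix l m ℝ}
    {B : Matrix m n ℝ} (hA : A ∈ Submodule.span ℝ s) (hB : B ∈ Submodule.span ℝ t) :
    A * B ∈ W := by
  induction hA, hB using Submodule.span_induction₂ with
  | mem_mem x y hx hy => exact h x hx y hy
  | zero_left => simp
  | zero_right => simp
  | add_left x y z _ _ _ hx hy => rw [Matrix.add_mul]; exact W.add_mem hx hy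
  | add_right x y z _ _ _ hx hy => rw [Matrix.mul_add]; exact W.add_mem hx hy
  | smul_left r x y _ _ hx => rw [Matrix.smul_mul]; exact W.smul_mem _ hx
  | smul_right r x y _ _ hx => rw [Matrix.mul_smul]; exact W.smul_mem _ hx

theorem mul_transpose_mem_of_mem_span {s : Set (Matrix l m ℝ)} {t : Set (Matrix n m ℝ)}
    {W : Submodule ℝ (Matrix l n ℝ)} (h : ∀ x ∈ s, ∀ y ∈ t, x * yᵀ ∈ W) {A : Matrix l m ℝ}
    {B : Matrix n m ℝ} (hA : A ∈ Submodule.span ℝ s) (hB : B ∈ Submodule.span ℝ t) :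
    A * Bᵀ ∈ W := by
  refine mul_mem_of_mem_span ?_ hA (transpose_mem_span hB)
  rintro x hx _ ⟨y, hy, rfl⟩
  exact h x hx y hy

theorem transpose_mul_mem_of_mem_span {s : Set (Matrix m l ℝ)} {t : Set (Matrix m n ℝ)}
    {W : Submodule ℝ (Matrix l n ℝ)} (h : ∀ x ∈ s, ∀ y ∈ t, xᵀ * y ∈ W) {A : Matrix m l ℝ}
    {B : Matrix m n ℝ} (hA : A ∈ Submodule.span ℝ s) (hB : B ∈ Submodule.span ℝ t) :
    Aᵀ * B ∈ W := by
  refine mul_mem_of_mem_span ?_ (transpose_mem_span hA) hB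
  rintro _ ⟨x, hx, rfl⟩ y hy
  exact h x hx y hy

theorem mul_transpose_comm_of_mem_span {s : Set (Matrix l m ℝ)}
    (h : ∀ x ∈ s, ∀ y ∈ s, x * yᵀ = y * xᵀ) {A B : Matrix l m ℝ}
    (hA : A ∈ Submodule.span ℝ s) (hB : B ∈ Submodule.span ℝ s) : A * Bᵀ = B * Aᵀ := by
  induction hA, hB using Submodule.span_induction₂ with
  | mem_mem x y hx hy => exact h x hx y hy
  | zero_left => simp
  | zero_right => simp
  | add_left x y z _ _ _ hx hy => simp [Matrix.add_mul, Matrix.mul_add, hx, hy]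
  | add_right x y z _ _ _ hx hy => simp [Matrix.add_mul, Matrix.mul_add, hx, hy]
  | smul_left r x y _ _ hx => simp [hx]
  | smul_right r x y _ _ hx => simp [hx]

end SpanMul

/-- The normalised all-ones matrix is an eigentripotent of any commutative triple system which
contains it. -/
theorem IsCommTripleSystem.const_mem_eigenTripotents {β γ : Type*} [Fintype β] [Fintype γ]
    [Nonempty β] [Nonempty γ] {V : Submodule ℝ (Matrix β γ ℝ)} (hV : IsCommTripleSystem V)
    (hJ : (Matrix.of fun _ _ => (1 : ℝ) : Matrix β γ ℝ) ∈ V) :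
    (Real.sqrt ((Fintype.card β : ℝ) * (Fintype.card γ : ℝ)))⁻¹ •
      (Matrix.of fun _ _ => (1 : ℝ) : Matrix β γ ℝ) ∈ eigenTripotents V := by
  have hpos : 0 < (Fintype.card β : ℝ) * (Fintype.card γ : ℝ) := by
    have hb : 0 < (Fintype.card β : ℝ) := Nat.cast_pos.mpr Fintype.card_pos
    have hg : 0 < (Fintype.card γ : ℝ) := Nat.cast_pos.mpr Fintype.card_pos
    exact mul_pos hb hg
  have hs := Real.sqrt_pos.mpr hpos
  have hsq := Real.sq_sqrt hpos.le
  obtain ⟨u₀⟩ := ‹Nonempty β›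
  obtain ⟨v₀⟩ := ‹Nonempty γ›
  refine ⟨V.smul_mem _ hJ, fun h => ?_, ?_, fun M hM N hN => ?_⟩
  · have := congrFun (congrFun h u₀) v₀
    simp only [Matrix.smul_apply, Matrix.of_apply, smul_eq_mul, mul_one, Matrix.zero_apply] at this
    exact inv_ne_zero hs.ne' this
  · ext u v
    simp only [Matrix.mul_apply, Matrix.transpose_apply, Matrix.smul_apply, Matrix.of_apply,
      smul_eq_mul, mul_one, Finset.sum_const, Finset.card_univ, nsmul_eq_mul]
    field_simp
    linarith
  · have hrot : M * Nᵀ * (Matrix.of fun _ _ => (1 : ℝ) : Matrix β γ ℝ) =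
        (Matrix.of fun _ _ => (1 : ℝ) : Matrix β γ ℝ) * (Nᵀ * M) := by
      rw [hV.triple_rotate hM hN hJ, Matrix.mul_assoc, hV.transpose_mul_comm M hM N hN]
    have hent : ∀ u v, (M * Nᵀ * (Matrix.of fun _ _ => (1 : ℝ) : Matrix β γ ℝ)) u v =
        ∑ w, (M * Nᵀ) u w := fun u v => by
      rw [Matrix.mul_apply]
      simp
    have hent' : ∀ u v, (M * Nᵀ * (Matrix.of fun _ _ => (1 : ℝ) : Matrix β γ ℝ)) u v =
        ∑ w, (Nᵀ * M) w v := fun u v => by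
      rw [hrot, Matrix.mul_apply]
      simp
    refine ⟨∑ w, (M * Nᵀ) u₀ w, ?_⟩
    rw [Matrix.mul_smul, smul_comm]
    congr 1
    ext u v
    rw [hent', ← hent' u₀ v, hent]
    simp

namespace BipartiteCC

variable {β γ : Type} [Fintype β] [DecidableEq β] [Fintype γ] [DecidableEq γ]

theorem sum_N_succ (cc : BipartiteCC β γ) :
    ∑ h : Fin cc.tbg, cc.N (h.val + 1) = Matrix.of fun _ _ => (1 : ℝ) := by
  rw [← cc.N_sum, Fin.sum_univ_eq_sum_range (fun h => cc.N (h + 1)), Finset.range_eq_Ico,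
    Finset.sum_Ico_add' cc.N 0 cc.tbg 1]
  rfl

theorem isCommTripleSystem (cc : BipartiteCC β γ) :
    IsCommTripleSystem (Submodule.span ℝ {M | ∃ h, 1 ≤ h ∧ h ≤ cc.tbg ∧ M = cc.N h}) where
  mul_transpose_comm M hM N hN := by
    refine mul_transpose_comm_of_mem_span ?_ hM hN
    rintro _ ⟨i, hi, hi', rfl⟩ _ ⟨j, hj, hj', rfl⟩
    exact cc.N_comm i hi hi' j hj hj'
  transpose_mul_comm M hM N hN := by
    refine mul_transpose_comm_of_mem_span ?_ (transpose_mem_span hM) (transpose_mem_span hN)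
    rintro _ ⟨_, ⟨i, hi, hi', rfl⟩, rfl⟩ _ ⟨_, ⟨j, hj, hj', rfl⟩, rfl⟩
    exact cc.Nt_comm i hi hi' j hj hj'
  triple_mem M hM N hN P hP := by
    refine mul_mem_of_mem_span (s := {M | ∃ i, i ≤ cc.tb ∧ M = cc.X i}) ?_ ?_ hP
    · rintro _ ⟨i, hi, rfl⟩ _ ⟨h, h1, h2, rfl⟩
      exact cc.X_mul_N i hi h h1 h2
    · refine mul_transpose_mem_of_mem_span ?_ hM hN
      rintro _ ⟨i, hi, hi', rfl⟩ _ ⟨j, hj, hj', rfl⟩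
      exact cc.N_mul_Nt i hi hi' j hj hj'

end BipartiteCC

/-- every bipartite coherent configuration admits a second basis
satisfying (D1)–(D5). -/
theorem bipartiteCC_second_basis (β γ : Type) [Fintype β] [DecidableEq β] [Nonempty β]
    [Fintype γ] [DecidableEq γ] [Nonempty γ] (cc : BipartiteCC β γ) :
    ∃ sb : SecondBasis cc,
      (∀ r, r ≤ cc.tb → ∀ s, s ≤ cc.tb →
        Matrix.hadamard (sb.L r) (sb.L s) ∈
          Submodule.span ℝ {M | ∃ r', r' ≤ cc.tb ∧ M = sb.L r'}) ∧
      (∀ r, r ≤ cc.tg → ∀ s, s ≤ cc.tg →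
        Matrix.hadamard (sb.R r) (sb.R s) ∈
          Submodule.span ℝ {M | ∃ r', r' ≤ cc.tg ∧ M = sb.R r'}) ∧
      (∀ r, r ≤ cc.tbg - 1 → ∀ s, s ≤ cc.tbg - 1 →
        Matrix.hadamard (sb.D r) (sb.D s) ∈
          Submodule.span ℝ {M | ∃ r', r' ≤ cc.tbg - 1 ∧ M = sb.D r'}) := by
  have hV := cc.isCommTripleSystem
  have hlt : ∀ {r}, r ≤ cc.tbg - 1 → r < cc.tbg := fun {r} hr => by
    have := cc.tbg_pos
    omega
  -- the partitions and their spans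
  have hX01 : ∀ (i : Fin (cc.tb + 1)) u v, cc.X i u v = 0 ∨ cc.X i u v = 1 :=
    fun i => cc.X_zero_one i (by omega)
  have hY01 : ∀ (i : Fin (cc.tg + 1)) u v, cc.Y i u v = 0 ∨ cc.Y i u v = 1 :=
    fun i => cc.Y_zero_one i (by omega)
  have hN01 : ∀ (i : Fin cc.tbg) u v, cc.N (i + 1) u v = 0 ∨ cc.N (i + 1) u v = 1 :=
    fun i => cc.N_zero_one _ (by omega) (by omega)
  have hXsum : ∑ i : Fin (cc.tb + 1), cc.X i = Matrix.of fun _ _ => (1 : ℝ) := by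
    rw [Fin.sum_univ_eq_sum_range, cc.X_sum]
  have hYsum : ∑ i : Fin (cc.tg + 1), cc.Y i = Matrix.of fun _ _ => (1 : ℝ) := by
    rw [Fin.sum_univ_eq_sum_range, cc.Y_sum]
  have hXrank : Module.finrank ℝ (Submodule.span ℝ {M | ∃ i, i ≤ cc.tb ∧ M = cc.X i}) =
      cc.tb + 1 := by
    rw [setOf_exists_le_eq, finrank_span_eq_card (linearIndependent_of_partition hX01 hXsum
      fun i => cc.X_ne_zero i (by omega)), Fintype.card_fin]
  have hYrank : Module.finrank ℝ (Submodule.span ℝ {M | ∃ i, i ≤ cc.tg ∧ M = cc.Y i}) =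
      cc.tg + 1 := by
    rw [setOf_exists_le_eq, finrank_span_eq_card (linearIndependent_of_partition hY01 hYsum
      fun i => cc.Y_ne_zero i (by omega)), Fintype.card_fin]
  have hNrank : Module.finrank ℝ
      (Submodule.span ℝ {M | ∃ h, 1 ≤ h ∧ h ≤ cc.tbg ∧ M = cc.N h}) = cc.tbg := by
    rw [setOf_exists_one_le_eq, finrank_span_eq_card (linearIndependent_of_partition hN01
      cc.sum_N_succ fun i => cc.N_ne_zero _ (by omega) (by omega)), Fintype.card_fin]
  have hJ : (Matrix.of fun _ _ => (1 : ℝ)) ∈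
      Submodule.span ℝ {M | ∃ h, 1 ≤ h ∧ h ≤ cc.tbg ∧ M = cc.N h} := by
    rw [← cc.sum_N_succ]
    exact Submodule.sum_mem _ fun h _ => Submodule.subset_span ⟨_, by omega, by omega, rfl⟩
  obtain ⟨D, hD0, hDt, hDind, hDspan, hDorth⟩ :=
    hV.exists_orthogonal_basis cc.tbg_pos hNrank (hV.const_mem_eigenTripotents hJ)
  have hDV : ∀ r < cc.tbg, D r ∈
      Submodule.span ℝ {M | ∃ h, 1 ≤ h ∧ h ≤ cc.tbg ∧ M = cc.N h} := fun r hr => (hDt r hr).1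
  have hND : ∀ h, 1 ≤ h → h ≤ cc.tbg →
      cc.N h ∈ Submodule.span ℝ (Set.range (fun r : Fin cc.tbg => D r.val)) := fun h h1 h2 => by
    rw [hDspan]
    exact Submodule.subset_span ⟨h, h1, h2, rfl⟩
  -- the left idempotents
  obtain ⟨L, hLP, hLmul, hLsum, hLind, hLspan⟩ :=
    exists_complete_orthogonal_idempotents (n := cc.tbg) (t := cc.tb)
      (P := fun r => D r * (D r)ᵀ) (W := Submodule.span ℝ {M | ∃ i, i ≤ cc.tb ∧ M = cc.X i})
      (fun r hr h => (hDt r hr).2.1 (eq_zero_of_mul_transpose_self h))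
      (fun r hr s hs => by
        split_ifs with hrs
        · subst hrs
          rw [← Matrix.mul_assoc, (hDt r hr).2.2.1]
        · rw [Matrix.mul_assoc, ← Matrix.mul_assoc (D r)ᵀ, (hDorth r hr s hs hrs).2,
            Matrix.zero_mul, Matrix.mul_zero])
      (by
        rw [cc.X_span]
        apply le_antisymm
        · rw [Submodule.span_le]
          rintro _ (rfl | ⟨i, hi, hi', j, hj, hj', rfl⟩)
          · exact Submodule.subset_span (Or.inl rfl)
          · refine mul_transpose_mem_of_mem_span ?_ (hND i hi hi') (hND j hj hj')
            rintro _ ⟨r, rfl⟩ _ ⟨s, rfl⟩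
            by_cases hrs : r = s
            · subst hrs
              exact Submodule.subset_span (Or.inr ⟨r, r.2, rfl⟩)
            · simp only [(hDorth r r.2 s s.2 (Fin.val_ne_of_ne hrs)).1, Submodule.zero_mem]
        · rw [Submodule.span_le]
          rintro _ (rfl | ⟨r, hr, rfl⟩)
          · exact Submodule.subset_span (Or.inl rfl)
          · refine mul_transpose_mem_of_mem_span ?_ (hDV r hr) (hDV r hr)
            rintro _ ⟨i, hi, hi', rfl⟩ _ ⟨j, hj, hj', rfl⟩
            exact Submodule.subset_span (Or.inr ⟨i, hi, hi', j, hj, hj', rfl⟩)) hXrank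
  -- the right idempotents
  obtain ⟨R, hRP, hRmul, hRsum, hRind, hRspan⟩ :=
    exists_complete_orthogonal_idempotents (n := cc.tbg) (t := cc.tg)
      (P := fun r => (D r)ᵀ * D r) (W := Submodule.span ℝ {M | ∃ i, i ≤ cc.tg ∧ M = cc.Y i})
      (fun r hr h => (hDt r hr).2.1 (eq_zero_of_transpose_mul_self h))
      (fun r hr s hs => by
        split_ifs with hrs
        · subst hrs
          rw [Matrix.mul_assoc, ← Matrix.mul_assoc (D r), (hDt r hr).2.2.1]
        · rw [Matrix.mul_assoc, ← Matrix.mul_assoc (D r), (hDorth r hr s hs hrs).1,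
            Matrix.zero_mul, Matrix.mul_zero])
      (by
        rw [cc.Y_span]
        apply le_antisymm
        · rw [Submodule.span_le]
          rintro _ (rfl | ⟨i, hi, hi', j, hj, hj', rfl⟩)
          · exact Submodule.subset_span (Or.inl rfl)
          · refine transpose_mul_mem_of_mem_span ?_ (hND i hi hi') (hND j hj hj')
            rintro _ ⟨r, rfl⟩ _ ⟨s, rfl⟩
            by_cases hrs : r = s
            · subst hrs
              exact Submodule.subset_span (Or.inr ⟨r, r.2, rfl⟩)
            · simp only [(hDorth r r.2 s s.2 (Fin.val_ne_of_ne hrs)).2, Submodule.zero_mem]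
        · rw [Submodule.span_le]
          rintro _ (rfl | ⟨r, hr, rfl⟩)
          · exact Submodule.subset_span (Or.inl rfl)
          · refine transpose_mul_mem_of_mem_span ?_ (hDV r hr) (hDV r hr)
            rintro _ ⟨i, hi, hi', rfl⟩ _ ⟨j, hj, hj', rfl⟩
            exact Submodule.subset_span (Or.inr ⟨i, hi, hi', j, hj, hj', rfl⟩)) hYrank
  rw [← setOf_exists_le_eq] at hLspan hRspan
  have hDspan' : Submodule.span ℝ {M | ∃ r, r ≤ cc.tbg - 1 ∧ M = D r} =
      Submodule.span ℝ {M | ∃ h, 1 ≤ h ∧ h ≤ cc.tbg ∧ M = cc.N h} := by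
    rw [setOf_exists_le_eq, Nat.sub_add_cancel cc.tbg_pos, hDspan]
  have hb : (Fintype.card β : ℝ) ≠ 0 := Nat.cast_ne_zero.mpr Fintype.card_ne_zero
  have hg : (Fintype.card γ : ℝ) ≠ 0 := Nat.cast_ne_zero.mpr Fintype.card_ne_zero
  have hs : (Real.sqrt ((Fintype.card β : ℝ) * (Fintype.card γ : ℝ)))⁻¹ *
      (Real.sqrt ((Fintype.card β : ℝ) * (Fintype.card γ : ℝ)))⁻¹ =
      (Fintype.card β : ℝ)⁻¹ * (Fintype.card γ : ℝ)⁻¹ := by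
    rw [← mul_inv, Real.mul_self_sqrt (by positivity), mul_inv]
  refine ⟨{ L := L, R := R, D := D, L_indep := hLind, R_indep := hRind, D_indep := hDind,
            L_span := hLspan, R_span := hRspan, D_span := hDspan',
            L_mul_L := fun r hr s hs => hLmul r (by omega) s (by omega),
            R_mul_R := fun r hr s hs => hRmul r (by omega) s (by omega),
            L_zero := ?_, D_zero := hD0, R_zero := ?_, L_sum := hLsum, R_sum := hRsum,
            L_eq_DDt := fun r hr => hLP r (hlt hr),
            R_eq_DtD := fun r hr => hRP r (hlt hr) }, ?_, ?_, ?_⟩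
  · rw [hLP 0 cc.tbg_pos, hD0]
    ext u v
    simp only [Matrix.mul_apply, Matrix.transpose_apply, Matrix.smul_apply, Matrix.of_apply,
      smul_eq_mul, mul_one, Finset.sum_const, Finset.card_univ, nsmul_eq_mul, hs]
    field_simp
  · rw [hRP 0 cc.tbg_pos, hD0]
    ext u v
    simp only [Matrix.mul_apply, Matrix.transpose_apply, Matrix.smul_apply, Matrix.of_apply,
      smul_eq_mul, mul_one, Finset.sum_const, Finset.card_univ, nsmul_eq_mul, hs]
    field_simp
  · intro r hr s hs
    have h : ∀ q, q ≤ cc.tb → L q ∈ Submodule.span ℝ {M | ∃ r', r' ≤ cc.tb ∧ M = L r'} :=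
      fun q hq => Submodule.subset_span ⟨q, hq, rfl⟩
    change _ ∈ Submodule.span ℝ {M | ∃ r', r' ≤ cc.tb ∧ M = L r'}
    rw [hLspan, setOf_exists_le_eq] at h ⊢
    exact hadamard_mem_span_of_partition hX01 hXsum (h r hr) (h s hs)
  · intro r hr s hs
    have h : ∀ q, q ≤ cc.tg → R q ∈ Submodule.span ℝ {M | ∃ r', r' ≤ cc.tg ∧ M = R r'} :=
      fun q hq => Submodule.subset_span ⟨q, hq, rfl⟩
    change _ ∈ Submodule.span ℝ {M | ∃ r', r' ≤ cc.tg ∧ M = R r'}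
    rw [hRspan, setOf_exists_le_eq] at h ⊢
    exact hadamard_mem_span_of_partition hY01 hYsum (h r hr) (h s hs)
  · intro r hr s hs
    have h := fun q hq => hDV q (hlt hq)
    change _ ∈ Submodule.span ℝ {M | ∃ r', r' ≤ cc.tbg - 1 ∧ M = D r'}
    rw [hDspan']
    rw [setOf_exists_one_le_eq] at h ⊢
    exact hadamard_mem_span_of_partition hN01 cc.sum_N_succ (h r hr) (h s hs)
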